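/- Let (W,U) be a graphon game and f a Nash equilibrium of (W,U). Let {G_n = (I_n, A_n, v_n)} be a sequence of network games converging to (W,U) and {s_n} a sequence of strategy profiles, s_n a strategy profile of G_n, such that f_{s_n}(t) → f(t) in norm for a.e. t ∈ (0,1]. Then there exists a sequence {ε_n} of nonnegative reals with ε_n → 0 such that s_n is an ε_n-Nash equilibrium of G_n for every n. -/

import Mathlib

open MeasureTheory Set Filter Topology

noncomputable section

variable {E : Type*} [NormedAddCommGroup E] [NormedSpace ℝ E]

/-- The common strategy set `S`, viewed as a subset of `E` with the weak topology. -/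
def weakS (S : Set E) : Set (WeakSpace ℝ E) := toWeakSpace ℝ E '' S

/-- The Banach space `C` of real-valued functions on `S × S` that are continuous for the
weak topology of `S`, with the supremum norm. (Since `S` is weakly compact, these are
exactly the bounded continuous functions on `S × S` with the weak topology.) -/
abbrev CGame (S : Set E) := BoundedContinuousFunction (↥(weakS S) × ↥(weakS S)) ℝ

/-- An element of `S`, as a point of `S` with the weak topology. -/
def memWeakS {S : Set E} {a : E} (ha : a ∈ S) : ↥(weakS S) :=
  ⟨toWeakSpace ℝ E a, a, ha, rfl⟩

/-- The agent space `(0,1]` with Lebesgue measure. -/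
def μ01 : Measure ℝ := volume.restrict (Set.Ioc (0 : ℝ) 1)

/-- Lebesgue measure on `(0,1]²`. -/
def μ01sq : Measure (ℝ × ℝ) := volume.restrict ((Set.Ioc (0 : ℝ) 1) ×ˢ (Set.Ioc (0 : ℝ) 1))

/-- The local aggregate `∫ W(t,s) f(s) dμ(s)` of a strategy profile `f`. -/
def agg (W : ℝ → ℝ → ℝ) (f : ℝ → E) (t : ℝ) : E := ∫ s, W t s • f s ∂μ01

/-- `(W, U)` is a graphon game: `W` is a graphon on `(0,1]` and `U` is a measurable map
from `(0,1]` to the closed unit ball `C₀` of `C`. -/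
def IsGraphonGame (S : Set E) (W : ℝ → ℝ → ℝ) (U : ℝ → CGame S) : Prop :=
  Measurable (Function.uncurry W) ∧
  (∀ t ∈ Set.Ioc (0 : ℝ) 1, ∀ s ∈ Set.Ioc (0 : ℝ) 1, W t s ∈ Set.Icc (0 : ℝ) 1) ∧
  StronglyMeasurable U ∧ (∀ t, ‖U t‖ ≤ 1)

/-- A strategy profile of a graphon game: a measurable function from agents to `S`. -/
def IsProfile (S : Set E) (f : ℝ → E) : Prop :=
  StronglyMeasurable f ∧ ∀ t, f t ∈ S

/-- `f` is a Nash equilibrium of the graphon game `(W, U)`: for a.e. agent `t`, `f t`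
maximizes `a ↦ U t (a, agg W f t)` over `S`. (The membership facts `f t ∈ S` and
`agg W f t ∈ S`, which always hold for strategy profiles since `S` is closed convex and
contains `0`, are quantified universally so that the utility can be evaluated.) -/
def IsNashEq (S : Set E) (W : ℝ → ℝ → ℝ) (U : ℝ → CGame S) (f : ℝ → E) : Prop :=
  ∀ᵐ t ∂μ01, ∀ (hft : f t ∈ S) (hag : agg W f t ∈ S), ∀ a, ∀ ha : a ∈ S,
    U t (memWeakS ha, memWeakS hag) ≤ U t (memWeakS hft, memWeakS hag)

/-- `f` is an `ε`-Nash equilibrium of the graphon game `(W, U)`: the set of agents whose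
strategy is `ε`-optimal has measure at least `1 - ε`. -/
def IsEpsNashEq (S : Set E) (W : ℝ → ℝ → ℝ) (U : ℝ → CGame S) (f : ℝ → E) (ε : ℝ) : Prop :=
  ENNReal.ofReal (1 - ε) ≤
    μ01 {t : ℝ | ∀ (hft : f t ∈ S) (hag : agg W f t ∈ S), ∀ a, ∀ ha : a ∈ S,
      U t (memWeakS ha, memWeakS hag) - ε ≤ U t (memWeakS hft, memWeakS hag)}

/-- A network game with `m` players, common strategy set `S`, adjacency matrix `A` with
entries in `[0,1]` and utility functions `v i` in the unit ball `C₀` of `C`. -/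
def IsNetworkGame (S : Set E) (m : ℕ) (A : Fin m → Fin m → ℝ) (v : Fin m → CGame S) : Prop :=
  0 < m ∧ (∀ i j, A i j ∈ Set.Icc (0 : ℝ) 1) ∧ (∀ i, ‖v i‖ ≤ 1)

/-- The local aggregate `m⁻¹ Σ_j A i j • s j` of player `i` in a network game. -/
def netAgg (m : ℕ) (A : Fin m → Fin m → ℝ) (s : Fin m → E) (i : Fin m) : E :=
  (m : ℝ)⁻¹ • ∑ j, A i j • s j

/-- `s` is an `ε`-Nash equilibrium of the network game `(m, A, v)`: the proportion of
players whose strategy is `ε`-optimal is at least `1 - ε`. -/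
def IsNetEpsNashEq (S : Set E) (m : ℕ) (A : Fin m → Fin m → ℝ) (v : Fin m → CGame S)
    (s : Fin m → E) (ε : ℝ) : Prop :=
  1 - ε ≤ (({i : Fin m | ∀ (hsi : s i ∈ S) (hag : netAgg m A s i ∈ S), ∀ a, ∀ ha : a ∈ S,
      v i (memWeakS ha, memWeakS hag) - ε ≤ v i (memWeakS hsi, memWeakS hag)}.ncard : ℝ)) / m

/-- The `m`-step function on `(0,1]` determined by the values `g i` on the intervals
`(i/m, (i+1)/m]`, with default value `x₀` outside `(0,1]`. -/
def stepOf {X : Type*} (m : ℕ) (g : Fin m → X) (x₀ : X) (t : ℝ) : X :=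
  if h : ∃ i : Fin m, t ∈ Set.Ioc ((i : ℝ) / m) (((i : ℝ) + 1) / m) then g h.choose else x₀

/-- The `m`-step graphon `W_A` associated with the adjacency matrix `A`. -/
def stepGraphonOf (m : ℕ) (A : Fin m → Fin m → ℝ) : ℝ → ℝ → ℝ :=
  fun t s => stepOf m (fun i => stepOf m (fun j => A i j) 0 s) 0 t

/-- The `m`-step utility profile `U_v` associated with the utilities `v`. -/
def stepUtilOf {S : Set E} (m : ℕ) (v : Fin m → CGame S) : ℝ → CGame S := stepOf m v 0

/-- The `m`-step strategy profile `f_s` associated with the strategies `s`. -/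
def stepProfileOf (m : ℕ) (s : Fin m → E) : ℝ → E := stepOf m s 0

/-- A sequence of network games `(m n, A n, v n)` converges to the graphon game `(W, U)`:
`W_{A_n} → W` a.e. on `(0,1]²`, `U_{v_n}(t) → U(t)` in the norm of `C` for a.e. `t`, and
the number of players tends to infinity. -/
def NetGamesTendsto (S : Set E) (m : ℕ → ℕ) (A : ∀ n, Fin (m n) → Fin (m n) → ℝ)
    (v : ∀ n, Fin (m n) → CGame S) (W : ℝ → ℝ → ℝ) (U : ℝ → CGame S) : Prop :=
  (∀ᵐ p ∂μ01sq, Tendsto (fun n => stepGraphonOf (m n) (A n) p.1 p.2) atTop (𝓝 (W p.1 p.2))) ∧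
  (∀ᵐ t ∂μ01, Tendsto (fun n => stepUtilOf (m n) (v n) t) atTop (𝓝 (U t))) ∧
  Tendsto m atTop atTop

end

section StepFunctions

variable {X : Type*} {m : ℕ}

lemma exists_mem_Ioc_step (hm : 0 < m) {t : ℝ} (ht : t ∈ Ioc (0 : ℝ) 1) :
    ∃ i : Fin m, t ∈ Ioc ((i : ℝ) / m) (((i : ℝ) + 1) / m) := by
  have hm' : (0 : ℝ) < m := by exact_mod_cast hm
  have hpos : 0 < ⌈t * m⌉₊ := Nat.ceil_pos.2 (mul_pos ht.1 hm')
  have hle : ⌈t * m⌉₊ ≤ m := Nat.ceil_le.2 (by nlinarith [ht.2])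
  have h1 : t * m ≤ ⌈t * m⌉₊ := Nat.le_ceil _
  have h2 : (⌈t * m⌉₊ : ℝ) < t * m + 1 := Nat.ceil_lt_add_one (mul_pos ht.1 hm').le
  have hc : ((⌈t * m⌉₊ - 1 : ℕ) : ℝ) = (⌈t * m⌉₊ : ℝ) - 1 := by
    rw [Nat.cast_sub hpos, Nat.cast_one]
  refine ⟨⟨⌈t * m⌉₊ - 1, by omega⟩, ?_, ?_⟩
  · simp only [hc]
    rw [div_lt_iff₀ hm']
    linarith
  · simp only [hc]
    rw [le_div_iff₀ hm']
    linarith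

lemma eq_of_mem_Ioc_step {t : ℝ} {i j : Fin m}
    (hi : t ∈ Ioc ((i : ℝ) / m) (((i : ℝ) + 1) / m))
    (hj : t ∈ Ioc ((j : ℝ) / m) (((j : ℝ) + 1) / m)) : i = j := by
  have hm : (0 : ℝ) < m := by exact_mod_cast i.pos
  obtain ⟨hi1, hi2⟩ := hi
  obtain ⟨hj1, hj2⟩ := hj
  rw [div_lt_iff₀ hm] at hi1 hj1
  rw [le_div_iff₀ hm] at hi2 hj2
  have h1 : (i : ℕ) < j + 1 := by exact_mod_cast hi1.trans_le hj2
  have h2 : (j : ℕ) < i + 1 := by exact_mod_cast hj1.trans_le hi2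
  exact Fin.ext (by omega)

lemma stepOf_eq (g : Fin m → X) (x₀ : X) {t : ℝ} {i : Fin m}
    (hi : t ∈ Ioc ((i : ℝ) / m) (((i : ℝ) + 1) / m)) : stepOf m g x₀ t = g i := by
  have h : ∃ i : Fin m, t ∈ Ioc ((i : ℝ) / m) (((i : ℝ) + 1) / m) := ⟨i, hi⟩
  rw [stepOf, dif_pos h, eq_of_mem_Ioc_step h.choose_spec hi]

lemma stepOf_eq_sum_indicator [AddCommMonoid X] (g : Fin m → X) (t : ℝ) :
    stepOf m g 0 t =
      ∑ i : Fin m, (Ioc ((i : ℝ) / m) (((i : ℝ) + 1) / m)).indicator (fun _ => g i) t := by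
  by_cases h : ∃ i : Fin m, t ∈ Ioc ((i : ℝ) / m) (((i : ℝ) + 1) / m)
  · obtain ⟨i, hi⟩ := h
    rw [stepOf_eq g 0 hi, Finset.sum_eq_single i, indicator_of_mem hi]
    · intro j _ hj
      exact indicator_of_notMem (fun h' => hj (eq_of_mem_Ioc_step h' hi)) _
    · simp
  · rw [stepOf, dif_neg h, Finset.sum_eq_zero]
    intro i _
    exact indicator_of_notMem (fun h' => h ⟨i, h'⟩) _

lemma stepOf_smul [AddCommGroup X] [Module ℝ X] (c : Fin m → ℝ) (g : Fin m → X) (t : ℝ) :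
    stepOf m c 0 t • stepOf m g 0 t = stepOf m (fun i => c i • g i) 0 t := by
  by_cases h : ∃ i : Fin m, t ∈ Ioc ((i : ℝ) / m) (((i : ℝ) + 1) / m)
  · obtain ⟨i, hi⟩ := h
    simp only [stepOf_eq _ _ hi]
  · simp only [stepOf, dif_neg h, smul_zero]

variable [NormedAddCommGroup X]

lemma stronglyMeasurable_stepOf (g : Fin m → X) : StronglyMeasurable (stepOf m g 0) := by
  have h : stepOf m g 0 = fun t => ∑ i : Fin m,
      (Ioc ((i : ℝ) / m) (((i : ℝ) + 1) / m)).indicator (fun _ => g i) t :=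
    funext (stepOf_eq_sum_indicator g)
  rw [h]
  exact Finset.stronglyMeasurable_fun_sum _
    fun i _ => stronglyMeasurable_const.indicator measurableSet_Ioc

lemma norm_stepOf_le {g : Fin m → X} {C : ℝ} (hC : 0 ≤ C) (hg : ∀ i, ‖g i‖ ≤ C) (t : ℝ) :
    ‖stepOf m g 0 t‖ ≤ C := by
  unfold stepOf
  split_ifs
  · exact hg _
  · simpa using hC

instance : IsProbabilityMeasure μ01 :=
  ⟨by simp [μ01]⟩

lemma integral_stepOf [NormedSpace ℝ X] [CompleteSpace X] (g : Fin m → X) :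
    ∫ t, stepOf m g 0 t ∂μ01 = (m : ℝ)⁻¹ • ∑ i, g i := by
  simp only [stepOf_eq_sum_indicator]
  rw [integral_finsetSum _ fun i _ => (integrable_const (g i)).indicator measurableSet_Ioc,
    Finset.smul_sum]
  refine Finset.sum_congr rfl fun i _ => ?_
  have hm : (0 : ℝ) < m := by exact_mod_cast i.pos
  have hsub : Ioc ((i : ℝ) / m) (((i : ℝ) + 1) / m) ⊆ Ioc (0 : ℝ) 1 := by
    refine Ioc_subset_Ioc (by positivity) ?_
    rw [div_le_one hm]
    exact_mod_cast i.isLt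
  rw [integral_indicator measurableSet_Ioc, setIntegral_const, measureReal_def, μ01,
    Measure.restrict_apply measurableSet_Ioc, inter_eq_left.2 hsub, Real.volume_Ioc,
    ENNReal.toReal_ofReal (sub_nonneg.2 (by gcongr; linarith))]
  congr 1
  field_simp
  ring

end StepFunctions

section WeaklyCompact

variable {E : Type*} [NormedAddCommGroup E] [NormedSpace ℝ E] {S : Set E}

lemma exists_norm_le_of_isCompact_weakS (h : IsCompact (weakS S)) :
    ∃ C : ℝ, 0 ≤ C ∧ ∀ x ∈ S, ‖x‖ ≤ C := by
  obtain ⟨C, hC⟩ := banach_steinhaus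
    (g := fun x : S => NormedSpace.inclusionInDoubleDual ℝ E (x : E)) (fun φ => by
      obtain ⟨C, hC⟩ := (h.image
        (WeakBilin.eval_continuous (topDualPairing ℝ E).flip φ)).isBounded.exists_norm_le
      exact ⟨C, fun x => hC _ ⟨_, ⟨x, x.2, rfl⟩, rfl⟩⟩)
  refine ⟨max C 0, le_max_right _ _, fun x hx => le_max_of_le_left ?_⟩
  have := hC ⟨x, hx⟩
  rwa [← (NormedSpace.inclusionInDoubleDualLi (E := E) ℝ).norm_map x]

lemma continuous_toWeakSpace : Continuous (toWeakSpace ℝ E) :=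
  (toWeakSpaceCLM ℝ E).continuous

lemma isClosed_of_isCompact_weakS (h : IsCompact (weakS S)) : IsClosed S := by
  have := h.isClosed.preimage (continuous_toWeakSpace (E := E))
  rwa [weakS, preimage_image_eq _ (toWeakSpace ℝ E).injective] at this

lemma tendsto_memWeakS {ι : Type*} {l : Filter ι} {x : ι → E} {y : E} (hx : ∀ i, x i ∈ S)
    (hy : y ∈ S) (h : Tendsto x l (𝓝 y)) :
    Tendsto (fun i => memWeakS (hx i)) l (𝓝 (memWeakS hy)) :=
  tendsto_subtype_rng.2 ((continuous_toWeakSpace.tendsto y).comp h)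

/-- The gain from an optimal deviation, for a player with utility `u`, strategy `x` and local
aggregate `z`. -/
noncomputable def regret (u : CGame S) (x z : ↥(weakS S)) : ℝ :=
  (⨆ a, u (a, z)) - u (x, z)

lemma bddAbove_range_utility (u : CGame S) (z : ↥(weakS S)) :
    BddAbove (range fun a => u (a, z)) :=
  ⟨‖u‖, by rintro _ ⟨a, rfl⟩; exact (le_abs_self _).trans (u.norm_coe_le_norm _)⟩

lemma sub_le_regret (u : CGame S) (x z a : ↥(weakS S)) : u (a, z) - u (x, z) ≤ regret u x z :=
  sub_le_sub_right (le_ciSup (bddAbove_range_utility u z) a) _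

lemma regret_nonneg (u : CGame S) (x z : ↥(weakS S)) : 0 ≤ regret u x z := by
  simpa using sub_le_regret u x z x

lemma regret_le {u : CGame S} {x z : ↥(weakS S)} {c : ℝ} (h : ∀ a, u (a, z) - u (x, z) ≤ c) :
    regret u x z ≤ c := by
  have : Nonempty ↥(weakS S) := ⟨x⟩
  have : ⨆ a, u (a, z) ≤ c + u (x, z) := ciSup_le fun a => by linarith [h a]
  unfold regret
  linarith

lemma regret_le_two {u : CGame S} (hu : ‖u‖ ≤ 1) (x z : ↥(weakS S)) : regret u x z ≤ 2 := by
  refine regret_le fun a => ?_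
  have h1 := abs_le.1 ((u.norm_coe_le_norm (a, z)).trans hu)
  have h2 := abs_le.1 ((u.norm_coe_le_norm (x, z)).trans hu)
  linarith [h1.2, h2.1]

lemma continuous_regret (h : IsCompact (weakS S)) :
    Continuous fun p : CGame S × ↥(weakS S) × ↥(weakS S) => regret p.1 p.2.1 p.2.2 := by
  have : CompactSpace ↥(weakS S) := isCompact_iff_compactSpace.1 h
  have key : Continuous fun p : CGame S × ↥(weakS S) × ↥(weakS S) =>
      sSup ((fun a => p.1 (a, p.2.2)) '' univ) :=
    isCompact_univ.continuous_sSup (f := fun (p : CGame S × ↥(weakS S) × ↥(weakS S)) a =>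
      p.1 (a, p.2.2)) (by
        simp only [Function.HasUncurry.uncurry, id]
        fun_prop)
  simp only [image_univ] at key
  exact key.sub (by fun_prop)

lemma tendsto_regret (h : IsCompact (weakS S)) {ι : Type*} {l : Filter ι} {u : ι → CGame S}
    {x z : ι → ↥(weakS S)} {u₀ : CGame S} {x₀ z₀ : ↥(weakS S)} (hu : Tendsto u l (𝓝 u₀))
    (hx : Tendsto x l (𝓝 x₀)) (hz : Tendsto z l (𝓝 z₀)) :
    Tendsto (fun i => regret (u i) (x i) (z i)) l (𝓝 (regret u₀ x₀ z₀)) := by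
  have hcont := continuous_regret h
  generalize regret (S := S) = G at *
  exact (hcont.tendsto (u₀, x₀, z₀)).comp (hu.prodMk_nhds (hx.prodMk_nhds hz))

end WeaklyCompact

section Games

variable {E : Type*} [NormedAddCommGroup E] [NormedSpace ℝ E] {S : Set E}

lemma netAgg_mem (hS0 : (0 : E) ∈ S) (hS : Convex ℝ S) {m : ℕ} (hm : 0 < m)
    {A : Fin m → Fin m → ℝ} (hA : ∀ i j, A i j ∈ Icc (0 : ℝ) 1) {s : Fin m → E}
    (hs : ∀ i, s i ∈ S) (i : Fin m) : netAgg m A s i ∈ S := by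
  have hm' : (m : ℝ) ≠ 0 := by exact_mod_cast hm.ne'
  rw [netAgg, Finset.smul_sum]
  exact hS.sum_mem (fun _ _ => by positivity) (by simp [hm'])
    fun j _ => hS.smul_mem_of_zero_mem hS0 (hs j) (hA i j)

lemma stepGraphonOf_smul_stepProfileOf {m : ℕ} (A : Fin m → Fin m → ℝ) (s : Fin m → E)
    {t : ℝ} {i : Fin m} (hi : t ∈ Ioc ((i : ℝ) / m) (((i : ℝ) + 1) / m)) (r : ℝ) :
    stepGraphonOf m A t r • stepProfileOf m s r = stepOf m (fun j => A i j • s j) 0 r := by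
  rw [stepGraphonOf, stepProfileOf, stepOf_eq _ _ hi, stepOf_smul]

lemma agg_step [CompleteSpace E] {m : ℕ} (A : Fin m → Fin m → ℝ) (s : Fin m → E) {t : ℝ}
    {i : Fin m} (hi : t ∈ Ioc ((i : ℝ) / m) (((i : ℝ) + 1) / m)) :
    agg (stepGraphonOf m A) (stepProfileOf m s) t = netAgg m A s i := by
  simp only [agg, stepGraphonOf_smul_stepProfileOf A s hi, integral_stepOf, netAgg]

lemma norm_smul_le_of_mem_Icc {c C : ℝ} (hc : c ∈ Icc (0 : ℝ) 1) {x : E} (hx : ‖x‖ ≤ C) :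
    ‖c • x‖ ≤ C := by
  rw [norm_smul, Real.norm_of_nonneg hc.1]
  exact (mul_le_of_le_one_left (norm_nonneg x) hc.2).trans hx

lemma ae_mem_Ioc_μ01 : ∀ᵐ t ∂μ01, t ∈ Ioc (0 : ℝ) 1 :=
  ae_restrict_mem measurableSet_Ioc

lemma ae_ae_of_ae_μ01sq {p : ℝ × ℝ → Prop} (h : ∀ᵐ x ∂μ01sq, p x) :
    ∀ᵐ t ∂μ01, ∀ᵐ s ∂μ01, p (t, s) := by
  rw [μ01sq, Measure.volume_eq_prod, ← Measure.prod_restrict] at h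
  exact Measure.ae_ae_of_ae_prod h

lemma agg_mem [CompleteSpace E] (hS0 : (0 : E) ∈ S) (hS : Convex ℝ S)
    (hScomp : IsCompact (weakS S)) {W : ℝ → ℝ → ℝ} (hW : Measurable (Function.uncurry W))
    (hWI : ∀ t ∈ Ioc (0 : ℝ) 1, ∀ s ∈ Ioc (0 : ℝ) 1, W t s ∈ Icc (0 : ℝ) 1) {f : ℝ → E}
    (hf : IsProfile S f) {t : ℝ} (ht : t ∈ Ioc (0 : ℝ) 1) : agg W f t ∈ S := by
  obtain ⟨C, -, hC⟩ := exists_norm_le_of_isCompact_weakS hScomp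
  have hWt : Measurable (W t) := hW.comp measurable_prodMk_left
  refine hS.integral_mem (isClosed_of_isCompact_weakS hScomp) ?_ ?_
  · filter_upwards [ae_mem_Ioc_μ01] with s hs
    exact hS.smul_mem_of_zero_mem hS0 (hf.2 s) (hWI t ht s hs)
  · refine Integrable.of_bound (hWt.stronglyMeasurable.smul hf.1).aestronglyMeasurable C ?_
    filter_upwards [ae_mem_Ioc_μ01] with s hs
    exact norm_smul_le_of_mem_Icc (hWI t ht s hs) (hC _ (hf.2 s))

/-- If the regrets `δ i` of the players average to at most `ε ^ 2`, then the profile is an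
`ε`-Nash equilibrium. -/
lemma isNetEpsNashEq_of_sum_regret_le {m : ℕ} (hm : 0 < m) {A : Fin m → Fin m → ℝ}
    {v : Fin m → CGame S} {s : Fin m → E} (hs : ∀ i, s i ∈ S)
    (hag : ∀ i, netAgg m A s i ∈ S) {ε : ℝ} (hε : 0 ≤ ε)
    (h : (m : ℝ)⁻¹ * ∑ i, regret (v i) (memWeakS (hs i)) (memWeakS (hag i)) ≤ ε ^ 2) :
    IsNetEpsNashEq S m A v s ε := by
  set δ : Fin m → ℝ := fun i => regret (v i) (memWeakS (hs i)) (memWeakS (hag i))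
  have hδ0 : ∀ i, 0 ≤ δ i := fun i => regret_nonneg _ _ _
  have hm' : (0 : ℝ) < m := by exact_mod_cast hm
  have hsum : ∑ i, δ i ≤ m * ε ^ 2 := by rwa [inv_mul_le_iff₀ hm'] at h
  set good := Finset.univ.filter fun i => δ i ≤ ε
  set bad := Finset.univ.filter fun i => ¬ δ i ≤ ε
  have hcard : (good.card : ℝ) + bad.card = m := by
    have := Finset.card_filter_add_card_filter_not (s := (Finset.univ : Finset (Fin m)))
      (fun i => δ i ≤ ε)
    rw [Finset.card_univ, Fintype.card_fin] at this
    exact_mod_cast this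
  have hbad : (bad.card : ℝ) ≤ ε * m := by
    rcases hε.eq_or_lt with rfl | hpos
    · have hz : ∑ i, δ i = 0 :=
        le_antisymm (by simpa using hsum) (Finset.sum_nonneg fun i _ => hδ0 i)
      have hall := (Finset.sum_eq_zero_iff_of_nonneg fun i _ => hδ0 i).1 hz
      have : bad = ∅ := Finset.filter_false_of_mem fun i hi => not_not.2 (hall i hi).le
      simp [this]
    · have h1 : (bad.card : ℝ) * ε ≤ ∑ i ∈ bad, δ i := by
        rw [← nsmul_eq_mul]
        exact Finset.card_nsmul_le_sum _ _ _
          fun i hi => (not_le.1 (Finset.mem_filter.1 hi).2).le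
      have h2 : ∑ i ∈ bad, δ i ≤ ∑ i, δ i :=
        Finset.sum_le_sum_of_subset_of_nonneg (Finset.filter_subset _ _) fun i _ _ => hδ0 i
      refine le_of_mul_le_mul_right ?_ hpos
      linarith
  have hsub : (good : Set (Fin m)) ⊆
      {i : Fin m | ∀ (hsi : s i ∈ S) (hag : netAgg m A s i ∈ S), ∀ a, ∀ ha : a ∈ S,
        v i (memWeakS ha, memWeakS hag) - ε ≤ v i (memWeakS hsi, memWeakS hag)} := by
    intro i hi _ _ a ha
    have h1 : δ i ≤ ε := (Finset.mem_filter.1 hi).2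
    have h2 := sub_le_regret (v i) (memWeakS (hs i)) (memWeakS (hag i)) (memWeakS ha)
    linarith
  have hle := Set.ncard_le_ncard hsub (Set.toFinite _)
  rw [Set.ncard_coe_finset] at hle
  rw [IsNetEpsNashEq, le_div_iff₀ hm']
  refine le_trans ?_ (Nat.cast_le.2 hle)
  linarith

end Games

/-- **Nash equilibria are limits of asymptotic Nash equilibria of network games**
(Corollary 4 of the paper). If `f` is a Nash equilibrium of the graphon game `(W, U)`,
`{G_n}` is a sequence of network games converging to `(W, U)` and `s_n` are strategy
profiles whose step representations converge a.e. to `f`, then there are `ε_n → 0`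
such that each `s_n` is an `ε_n`-Nash equilibrium of `G_n`. -/
theorem nash_is_limit_of_network_asymptotic_nash
    {E : Type*} [NormedAddCommGroup E] [NormedSpace ℝ E] [CompleteSpace E]
    [TopologicalSpace.SeparableSpace E]
    (S : Set E) (hS0 : (0 : E) ∈ S) (hSconv : Convex ℝ S) (hScomp : IsCompact (weakS S))
    (W : ℝ → ℝ → ℝ) (U : ℝ → CGame S) (hG : IsGraphonGame S W U)
    (f : ℝ → E) (hf : IsProfile S f) (hfNash : IsNashEq S W U f)
    (m : ℕ → ℕ) (A : ∀ n, Fin (m n) → Fin (m n) → ℝ) (v : ∀ n, Fin (m n) → CGame S)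
    (hnet : ∀ n, IsNetworkGame S (m n) (A n) (v n))
    (s : ∀ n, Fin (m n) → E) (hs : ∀ n i, s n i ∈ S)
    (hconv : NetGamesTendsto S m A v W U)
    (hfconv : ∀ᵐ t ∂μ01, Tendsto (fun n => stepProfileOf (m n) (s n) t) atTop (𝓝 (f t))) :
    ∃ ε : ℕ → ℝ, (∀ n, 0 ≤ ε n) ∧
      (∀ n, IsNetEpsNashEq S (m n) (A n) (v n) (s n) (ε n)) ∧
      Tendsto ε atTop (𝓝 0) := by
  obtain ⟨hW, hWI, -, -⟩ := hG
  obtain ⟨hWconv, hUconv, -⟩ := hconv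
  obtain ⟨C, hC0, hC⟩ := exists_norm_le_of_isCompact_weakS hScomp
  have hag : ∀ n i, netAgg (m n) (A n) (s n) i ∈ S := fun n i =>
    netAgg_mem hS0 hSconv (hnet n).1 (hnet n).2.1 (hs n) i
  set δ : ∀ n, Fin (m n) → ℝ := fun n i =>
    regret (v n i) (memWeakS (hs n i)) (memWeakS (hag n i))
  have hlim : Tendsto (fun n => ∫ t, stepOf (m n) (δ n) 0 t ∂μ01) atTop (𝓝 0) := by
    suffices h : Tendsto (fun n => ∫ t, stepOf (m n) (δ n) 0 t ∂μ01) atTop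
        (𝓝 (∫ _, (0 : ℝ) ∂μ01)) by rwa [integral_zero] at h
    refine tendsto_integral_of_dominated_convergence (fun _ => 2)
      (fun n => (stronglyMeasurable_stepOf _).aestronglyMeasurable) (integrable_const _)
      (fun n => Eventually.of_forall (norm_stepOf_le zero_le_two fun i => ?_)) ?_
    · rw [Real.norm_of_nonneg (regret_nonneg _ _ _)]
      exact regret_le_two ((hnet n).2.2 i) _ _
    filter_upwards [ae_mem_Ioc_μ01, ae_ae_of_ae_μ01sq hWconv, hUconv, hfconv, hfNash]
      with t ht hWt hUt hft hNash
    have hagt : agg W f t ∈ S := agg_mem hS0 hSconv hScomp hW hWI hf ht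
    choose k hk using fun n => exists_mem_Ioc_step (hnet n).1 ht
    have haggt : Tendsto (fun n => netAgg (m n) (A n) (s n) (k n)) atTop (𝓝 (agg W f t)) := by
      simp only [← fun n => agg_step (A n) (s n) (hk n)]
      refine tendsto_integral_of_dominated_convergence (fun _ => C) (fun n => ?_)
        (integrable_const _) (fun n => Eventually.of_forall fun r => ?_) ?_
      · simp only [stepGraphonOf_smul_stepProfileOf _ _ (hk n)]
        exact (stronglyMeasurable_stepOf _).aestronglyMeasurable
      · rw [stepGraphonOf_smul_stepProfileOf _ _ (hk n)]
        exact norm_stepOf_le hC0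
          (fun j => norm_smul_le_of_mem_Icc ((hnet n).2.1 _ _) (hC _ (hs n j))) r
      · filter_upwards [hWt, hfconv] with r hWr hfr
        exact hWr.smul hfr
    simp only [stepUtilOf, stepProfileOf, fun n => stepOf_eq (v n) 0 (hk n),
      fun n => stepOf_eq (s n) 0 (hk n)] at hUt hft
    simp only [fun n => stepOf_eq (δ n) 0 (hk n)]
    have hzero : regret (U t) (memWeakS (hf.2 t)) (memWeakS hagt) = 0 := by
      refine le_antisymm (regret_le ?_) (regret_nonneg _ _ _)
      rintro ⟨_, a, ha, rfl⟩
      exact sub_nonpos.2 (hNash (hf.2 t) hagt a ha)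
    rw [← hzero]
    exact tendsto_regret hScomp hUt (tendsto_memWeakS (fun n => hs n (k n)) (hf.2 t) hft)
      (tendsto_memWeakS (fun n => hag n (k n)) hagt haggt)
  refine ⟨fun n => √(∫ t, stepOf (m n) (δ n) 0 t ∂μ01), fun n => Real.sqrt_nonneg _,
    fun n => ?_, by simpa using hlim.sqrt⟩
  refine isNetEpsNashEq_of_sum_regret_le (hnet n).1 (hs n) (hag n) (Real.sqrt_nonneg _) ?_
  simp only [integral_stepOf, smul_eq_mul]
  rw [Real.sq_sqrt]
  exact mul_nonneg (by positivity) (Finset.sum_nonneg fun i _ => regret_nonneg _ _ _)
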